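/- arXiv:cs/0603048 — 10 statements merged into one kernel-verified Lean document; each statement's English description precedes it below -/
import Mathlib

section
/- Let H be a homogeneous relation on a finite set V. If A and B are homogeneous sets of H that overlap, then A ∩ B and A ∪ B are homogeneous sets of H. -/
/-- Two sets overlap: their intersection and both differences are nonempty. -/
def Overlaps {V : Type*} (A B : Set V) : Prop :=
  (A ∩ B).Nonempty ∧ (A \ B).Nonempty ∧ (B \ A).Nonempty

/-- `H` is a homogeneous relation: for each `s`, `H s · ·` is an equivalence
relation on `V \ {s}` (symmetry, reflexivity on reflectless triples, transitivity). -/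
def IsHomRel {V : Type*} (H : V → V → V → Prop) : Prop :=
  (∀ s x y : V, H s x y → H s y x) ∧
  (∀ s x : V, s ≠ x → H s x x) ∧
  (∀ s x y z : V, H s x y → H s y z → H s x z)

/-- `M` is a homogeneous set of `H`: nonempty and homogeneous w.r.t. every `s ∉ M`. -/
def IsHomSet {V : Type*} (H : V → V → V → Prop) (M : Set V) : Prop :=
  M.Nonempty ∧ ∀ s ∉ M, ∀ x ∈ M, ∀ y ∈ M, H s x y

/-- Closure under intersection and union of overlapping homogeneous sets. -/
theorem overlapping_homSets_inter_union {V : Type*} [Fintype V]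
    (H : V → V → V → Prop) (hH : IsHomRel H)
    (A B : Set V) (hA : IsHomSet H A) (hB : IsHomSet H B) (hAB : Overlaps A B) :
    IsHomSet H (A ∩ B) ∧ IsHomSet H (A ∪ B) := by
  obtain ⟨c, hcA, hcB⟩ := hAB.1
  refine ⟨⟨hAB.1, fun s hs x hx y hy => ?_⟩, ⟨c, Or.inl hcA⟩, fun s hs x hx y hy => ?_⟩
  · by_cases hsA : s ∈ A
    · exact hB.2 s (fun hsB => hs ⟨hsA, hsB⟩) x hx.2 y hy.2
    · exact hA.2 s hsA x hx.1 y hy.1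
  · have related_to_common : ∀ z ∈ A ∪ B, H s z c := by
      rintro z (hz | hz)
      · exact hA.2 s (fun h => hs (Or.inl h)) z hz c hcA
      · exact hB.2 s (fun h => hs (Or.inr h)) z hz c hcB
    exact hH.2.2 s x c y (related_to_common x hx) (hH.1 s y c (related_to_common y hy))
end

section
/- Let H be a homogeneous relation on a finite set V and let F'_H = F_H ∪ {∅}. Then (F'_H, ⊆) is a lattice: any two members A, B of F'_H have a greatest lower bound (namely A ∩ B) and a least upper bound (the smallest member of F'_H containing A ∪ B) in F'_H. -/
/-- The family of homogeneous sets of `H`. -/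
def HomFamily {V : Type*} (H : V → V → V → Prop) : Set (Set V) :=
  {M | IsHomSet H M}

/-- Adding the empty set to the homogeneous sets amounts to dropping nonemptiness. -/
theorem mem_homFamily_union_empty {V : Type*} {H : V → V → V → Prop} {M : Set V} :
    M ∈ HomFamily H ∪ {(∅ : Set V)} ↔ ∀ s ∉ M, ∀ x ∈ M, ∀ y ∈ M, H s x y := by
  constructor
  · rintro (hM | rfl)
    · exact hM.2
    · intro s _ x hx
      exact hx.elim
  · intro hM
    rcases M.eq_empty_or_nonempty with h | h
    · exact Or.inr h
    · exact Or.inl ⟨h, hM⟩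

/-- The homogeneous sets together with the empty set are closed under intersections. -/
theorem sInter_mem_homFamily_union_empty {V : Type*} {H : V → V → V → Prop} {S : Set (Set V)}
    (hS : S ⊆ HomFamily H ∪ {(∅ : Set V)}) : ⋂₀ S ∈ HomFamily H ∪ {(∅ : Set V)} := by
  rw [mem_homFamily_union_empty]
  intro s hs x hx y hy
  simp only [Set.mem_sInter, not_forall] at hs
  obtain ⟨M, hM, hsM⟩ := hs
  exact mem_homFamily_union_empty.1 (hS hM) s hsM x (hx M hM) y (hy M hM)

/-- `F'_H = F_H ∪ {∅}` ordered by inclusion is a lattice: `A ∩ B` is the greatest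
lower bound of `A` and `B`, and there is a least upper bound (the smallest member
containing `A ∪ B`). -/
theorem homFamily_with_empty_lattice {V : Type*} [Fintype V]
    (H : V → V → V → Prop) (hH : IsHomRel H) :
    ∀ A ∈ HomFamily H ∪ {(∅ : Set V)}, ∀ B ∈ HomFamily H ∪ {(∅ : Set V)},
      (A ∩ B ∈ HomFamily H ∪ {(∅ : Set V)} ∧ A ∩ B ⊆ A ∧ A ∩ B ⊆ B ∧
        ∀ C ∈ HomFamily H ∪ {(∅ : Set V)}, C ⊆ A → C ⊆ B → C ⊆ A ∩ B) ∧
      (∃ U ∈ HomFamily H ∪ {(∅ : Set V)}, A ∪ B ⊆ U ∧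
        ∀ W ∈ HomFamily H ∪ {(∅ : Set V)}, A ⊆ W → B ⊆ W → U ⊆ W) := by
  intro A hA B hB
  refine ⟨⟨?_, Set.inter_subset_left, Set.inter_subset_right,
    fun C _ hCA hCB => Set.subset_inter hCA hCB⟩,
    ⋂₀ {W | W ∈ HomFamily H ∪ {(∅ : Set V)} ∧ A ∪ B ⊆ W},
    sInter_mem_homFamily_union_empty fun W hW => hW.1,
    Set.subset_sInter fun W hW => hW.2,
    fun W hW hAW hBW => Set.sInter_subset_of_mem ⟨hW, Set.union_subset hAW hBW⟩⟩
  rw [← Set.sInter_pair]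
  exact sInter_mem_homFamily_union_empty (Set.pair_subset hA hB)
end

section
/- Let H be a homogeneous relation on a finite set V and let A ⊆ V be nonempty. Then the family F(A) = {F ∈ F_H : A ⊆ F} of homogeneous sets containing A, ordered by inclusion, is a distributive lattice; in particular it is closed under union and intersection, with meet given by intersection and join given by union. -/
theorem IsHomSet.inter {V : Type*} {H : V → V → V → Prop} {X Y : Set V}
    (hX : IsHomSet H X) (hY : IsHomSet H Y) (hXY : (X ∩ Y).Nonempty) :
    IsHomSet H (X ∩ Y) := by
  refine ⟨hXY, fun s hs x hx y hy => ?_⟩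
  by_cases hsX : s ∈ X
  · exact hY.2 s (fun hsY => hs ⟨hsX, hsY⟩) x hx.2 y hy.2
  · exact hX.2 s hsX x hx.1 y hy.1

theorem IsHomSet.union {V : Type*} {H : V → V → V → Prop} (hH : IsHomRel H) {X Y : Set V}
    (hX : IsHomSet H X) (hY : IsHomSet H Y) (hXY : (X ∩ Y).Nonempty) :
    IsHomSet H (X ∪ Y) := by
  obtain ⟨a, haX, haY⟩ := hXY
  refine ⟨⟨a, Or.inl haX⟩, fun s hs => ?_⟩
  have hsa : ∀ x ∈ X ∪ Y, H s x a := by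
    rintro x (hx | hx)
    · exact hX.2 s (fun h => hs (Or.inl h)) x hx a haX
    · exact hY.2 s (fun h => hs (Or.inr h)) x hx a haY
  exact fun x hx y hy => hH.2.2 s x a y (hsa x hx) (hH.1 s y a (hsa y hy))

/-- The family `F(A)` of homogeneous sets of `H` containing a nonempty set `A`,
ordered by inclusion, is a distributive lattice: it is closed under union and
intersection (which are join and meet), and these distribute over each other. -/
theorem homSets_containing_distributive_lattice {V : Type*} [Fintype V]
    (H : V → V → V → Prop) (hH : IsHomRel H) (A : Set V) (hA : A.Nonempty) :
    ∀ X ∈ {F | IsHomSet H F ∧ A ⊆ F}, ∀ Y ∈ {F | IsHomSet H F ∧ A ⊆ F},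
      X ∩ Y ∈ {F | IsHomSet H F ∧ A ⊆ F} ∧
      X ∪ Y ∈ {F | IsHomSet H F ∧ A ⊆ F} ∧
      ∀ Z ∈ {F | IsHomSet H F ∧ A ⊆ F},
        X ∩ (Y ∪ Z) = (X ∩ Y) ∪ (X ∩ Z) ∧ X ∪ (Y ∩ Z) = (X ∪ Y) ∩ (X ∪ Z) := by
  rintro X ⟨hX, hAX⟩ Y ⟨hY, hAY⟩
  have hAXY : A ⊆ X ∩ Y := Set.subset_inter hAX hAY
  have hXY : (X ∩ Y).Nonempty := hA.mono hAXY
  exact ⟨⟨hX.inter hY hXY, hAXY⟩,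
    ⟨hX.union hH hY hXY, hAX.trans Set.subset_union_left⟩,
    fun Z _ => ⟨Set.inter_union_distrib_left X Y Z, Set.union_inter_distrib_left X Y Z⟩⟩
end

section
/- (Submodularity) Let H be a homogeneous relation on a finite set V and for X ⊆ V let s(X) denote the number of splitters of X. Then for all overlapping sets X, Y ⊆ V, s(X) + s(Y) ≥ s(X ∪ Y) + s(X ∩ Y). -/
/-- The set of splitters of `X`: elements outside `X` that distinguish `X`. -/
def Splitters {V : Type*} (H : V → V → V → Prop) (X : Set V) : Set V :=
  {s | s ∉ X ∧ ∃ x ∈ X, ∃ y ∈ X, ¬ H s x y}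

/-- An element splitting the union of two intersecting sets splits one of them. -/
theorem splitters_union_subset {V : Type*} {H : V → V → V → Prop} (hH : IsHomRel H)
    {X Y : Set V} (hXY : (X ∩ Y).Nonempty) :
    Splitters H (X ∪ Y) ⊆ Splitters H X ∪ Splitters H Y := by
  obtain ⟨hsymm, -, htrans⟩ := hH
  obtain ⟨z, hzX, hzY⟩ := hXY
  rintro s ⟨hs, x, hx, y, hy, hxy⟩
  by_contra hcon
  have hX : ∀ a ∈ X, ∀ b ∈ X, H s a b := fun a ha b hb ↦ by
    by_contra h
    exact hcon (Or.inl ⟨fun h' ↦ hs (Or.inl h'), a, ha, b, hb, h⟩)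
  have hY : ∀ a ∈ Y, ∀ b ∈ Y, H s a b := fun a ha b hb ↦ by
    by_contra h
    exact hcon (Or.inr ⟨fun h' ↦ hs (Or.inr h'), a, ha, b, hb, h⟩)
  have hz : ∀ a ∈ X ∪ Y, H s a z := fun a ha ↦
    ha.elim (fun h ↦ hX a h z hzX) (fun h ↦ hY a h z hzY)
  exact hxy (htrans s x z y (hz x hx) (hsymm s y z (hz y hy)))

/-- An element splitting an intersection splits one of the two sets. -/
theorem splitters_inter_subset {V : Type*} (H : V → V → V → Prop) (X Y : Set V) :
    Splitters H (X ∩ Y) ⊆ Splitters H X ∪ Splitters H Y := by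
  rintro s ⟨hs, x, hx, y, hy, hxy⟩
  by_cases hsX : s ∈ X
  · exact Or.inr ⟨fun h ↦ hs ⟨hsX, h⟩, x, hx.2, y, hy.2, hxy⟩
  · exact Or.inl ⟨hsX, x, hx.1, y, hy.1, hxy⟩

/-- An element splitting both the union and the intersection splits both sets. -/
theorem splitters_union_inter_subset {V : Type*} (H : V → V → V → Prop) (X Y : Set V) :
    Splitters H (X ∪ Y) ∩ Splitters H (X ∩ Y) ⊆ Splitters H X ∩ Splitters H Y := by
  rintro s ⟨⟨hs, -⟩, -, x, hx, y, hy, hxy⟩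
  exact ⟨⟨fun h ↦ hs (Or.inl h), x, hx.1, y, hy.1, hxy⟩,
    ⟨fun h ↦ hs (Or.inr h), x, hx.2, y, hy.2, hxy⟩⟩

/-- Submodularity of the number of splitters: for overlapping `X, Y`,
`s(X) + s(Y) ≥ s(X ∪ Y) + s(X ∩ Y)`. -/
theorem splitters_ncard_submodular {V : Type*} [Fintype V]
    (H : V → V → V → Prop) (hH : IsHomRel H)
    (X Y : Set V) (hXY : Overlaps X Y) :
    (Splitters H (X ∪ Y)).ncard + (Splitters H (X ∩ Y)).ncard ≤
      (Splitters H X).ncard + (Splitters H Y).ncard := by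
  rw [← Set.ncard_union_add_ncard_inter (Splitters H (X ∪ Y)),
    ← Set.ncard_union_add_ncard_inter (Splitters H X)]
  exact Nat.add_le_add
    (Set.ncard_le_ncard (Set.union_subset (splitters_union_subset hH hXY.1)
      (splitters_inter_subset H X Y)))
    (Set.ncard_le_ncard (splitters_union_inter_subset H X Y))
end

section
/- Let H be a homogeneous relation on a finite set V and let X, Y ⊆ V be overlapping sets. Then S_{X∪Y} \ S_X ⊆ S_Y \ S_{X∩Y}, i.e., every element that distinguishes X ∪ Y but does not distinguish X distinguishes Y and does not distinguish X ∩ Y. -/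
/-- For overlapping `X, Y`: every element distinguishing `X ∪ Y` but not `X`
distinguishes `Y` and does not distinguish `X ∩ Y`. -/
theorem splitters_union_diff_subset {V : Type*} [Fintype V]
    (H : V → V → V → Prop) (hH : IsHomRel H)
    (X Y : Set V) (hXY : Overlaps X Y) :
    Splitters H (X ∪ Y) \ Splitters H X ⊆ Splitters H Y \ Splitters H (X ∩ Y) := by
  obtain ⟨symm, -, trans⟩ := hH
  obtain ⟨⟨z, hzX, hzY⟩, -, -⟩ := hXY
  rintro s ⟨⟨hs, x, hx, y, hy, hxy⟩, hsX⟩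
  have hX : ∀ a ∈ X, ∀ b ∈ X, H s a b := by
    intro a ha b hb
    by_contra hab
    exact hsX ⟨fun h => hs (Or.inl h), a, ha, b, hb, hab⟩
  refine ⟨⟨fun h => hs (Or.inr h), ?_⟩, ?_⟩
  · by_contra! hY
    have hz : ∀ a ∈ X ∪ Y, H s a z := by
      rintro a (ha | ha)
      · exact hX a ha z hzX
      · exact hY a ha z hzY
    exact hxy (trans s x z y (hz x hx) (symm s y z (hz y hy)))
  · rintro ⟨-, a, ha, b, hb, hab⟩
    exact hab (hX a ha.1 b hb.1)
end

section
/- Let F be a family of subsets of a finite set V that contains V and all singletons and is closed under union of overlapping members. Then the map sending an overlap class to its support is a bijection between the nontrivial overlap classes of F and the decomposable strong members of F; moreover, the overlap class whose support is a decomposable strong member D consists exactly of the weak children of D. -/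
/-- The overlap relation restricted to members of the family `F`. -/
def OvRel {V : Type*} (F : Set (Set V)) (A B : Set V) : Prop :=
  A ∈ F ∧ B ∈ F ∧ Overlaps A B

/-- `C` is an overlap class of `F`: an equivalence class of the reflexive-transitive
closure of the overlap relation on `F`. -/
def IsOverlapClass {V : Type*} (F : Set (Set V)) (C : Set (Set V)) : Prop :=
  ∃ A ∈ F, C = {B | B ∈ F ∧ Relation.ReflTransGen (OvRel F) A B}

/-- A member of `F` is strong if it overlaps no other member of `F`. -/
def IsStrong {V : Type*} (F : Set (Set V)) (A : Set V) : Prop :=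
  A ∈ F ∧ ∀ B ∈ F, B ≠ A → ¬ Overlaps A B

/-- `P` is the parent of `M` (and `M` a child of `P`): `P` is the smallest strong
member of `F` properly containing `M`. -/
def IsChild {V : Type*} (F : Set (Set V)) (M P : Set V) : Prop :=
  M ∈ F ∧ IsStrong F P ∧ M ⊂ P ∧ ∀ Q, IsStrong F Q → M ⊂ Q → P ⊆ Q

/-- `M` is a weak child of `P`: a child of `P` that is not strong. -/
def IsWeakChild {V : Type*} (F : Set (Set V)) (M P : Set V) : Prop :=
  IsChild F M P ∧ ¬ IsStrong F M

/-- A strong member of `F` is decomposable if it has at least one weak child. -/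
def IsDecomposable {V : Type*} (F : Set (Set V)) (D : Set V) : Prop :=
  IsStrong F D ∧ ∃ M, IsWeakChild F M D

theorem Overlaps.symm {V : Type*} {A B : Set V} (h : Overlaps A B) : Overlaps B A :=
  ⟨Set.inter_comm A B ▸ h.1, h.2.2, h.2.1⟩

theorem not_overlaps_iff {V : Type*} {A B : Set V} :
    ¬ Overlaps A B ↔ ¬ (A ∩ B).Nonempty ∨ A ⊆ B ∨ B ⊆ A := by
  simp only [Overlaps, not_and_or, Set.sdiff_nonempty, not_not]

theorem Overlaps.ne {V : Type*} {A B : Set V} (h : Overlaps A B) : A ≠ B := by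
  rintro rfl
  obtain ⟨x, hx, hx'⟩ := h.2.1
  exact hx' hx

theorem OvRel.symm {V : Type*} {F : Set (Set V)} {A B : Set V} (h : OvRel F A B) : OvRel F B A :=
  ⟨h.2.1, h.1, h.2.2.symm⟩

theorem IsStrong.not_overlaps {V : Type*} {F : Set (Set V)} {A B : Set V} (hA : IsStrong F A)
    (hB : B ∈ F) : ¬ Overlaps A B :=
  fun h => hA.2 B hB h.ne.symm h

theorem exists_ovRel_of_not_isStrong {V : Type*} {F : Set (Set V)} {A : Set V} (hA : A ∈ F)
    (h : ¬ IsStrong F A) : ∃ B, OvRel F A B := by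
  by_contra! hn
  exact h ⟨hA, fun B hB _ hAB => hn B ⟨hA, hB, hAB⟩⟩

/-- The overlap class of `A` in `F`. -/
def overlapClass {V : Type*} (F : Set (Set V)) (A : Set V) : Set (Set V) :=
  {B | B ∈ F ∧ Relation.ReflTransGen (OvRel F) A B}

theorem mem_overlapClass_self {V : Type*} {F : Set (Set V)} {A : Set V} (hA : A ∈ F) :
    A ∈ overlapClass F A :=
  ⟨hA, .refl⟩

theorem mem_overlapClass_of_ovRel {V : Type*} {F : Set (Set V)} {A B B' : Set V}
    (hB : B ∈ overlapClass F A) (h : OvRel F B B') : B' ∈ overlapClass F A :=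
  ⟨h.2.1, hB.2.tail h⟩

theorem overlapClass_eq_of_mem {V : Type*} {F : Set (Set V)} {A B : Set V}
    (hB : B ∈ overlapClass F A) : overlapClass F B = overlapClass F A := by
  have : Std.Symm (OvRel F) := ⟨fun _ _ h => h.symm⟩
  have hsymm : Relation.ReflTransGen (OvRel F) B A := Std.Symm.symm _ _ hB.2
  ext M
  exact ⟨fun h => ⟨h.1, hB.2.trans h.2⟩, fun h => ⟨h.1, hsymm.trans h.2⟩⟩

/-- A set that contains one member of an overlap class and overlaps none of them contains the
whole support. -/
theorem sUnion_overlapClass_subset {V : Type*} {F : Set (Set V)} {A Q : Set V} (hAQ : A ⊆ Q)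
    (hQ : ∀ B ∈ overlapClass F A, ¬ Overlaps B Q) : ⋃₀ overlapClass F A ⊆ Q := by
  refine Set.sUnion_subset fun B hB => ?_
  obtain ⟨-, hB⟩ := hB
  induction hB with
  | refl => exact hAQ
  | @tail B B' hAB hBB' ih =>
    have hB' : B' ∈ overlapClass F A := ⟨hBB'.2.1, hAB.tail hBB'⟩
    obtain ⟨y, hyB, hyB'⟩ := hBB'.2.2.1
    rcases not_overlaps_iff.1 (hQ B' hB') with h | h | h
    · exact absurd ⟨y, hyB', ih hyB⟩ h
    · exact h
    · obtain ⟨z, hz, hz'⟩ := hBB'.2.2.2.1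
      exact absurd (h (ih hz)) hz'

theorem sUnion_overlapClass_mem {V : Type*} [Finite V] {F : Set (Set V)}
    (hclosed : ∀ A ∈ F, ∀ B ∈ F, Overlaps A B → A ∪ B ∈ F) {A : Set V} (hA : A ∈ F) :
    ⋃₀ overlapClass F A ∈ F := by
  obtain ⟨X, hAX, hX⟩ := (Set.toFinite {X | X ∈ F ∧ X ⊆ ⋃₀ overlapClass F A}).exists_le_maximal
    (a := A) ⟨hA, Set.subset_sUnion_of_mem (mem_overlapClass_self hA)⟩
  have key : ∀ B ∈ overlapClass F A, ¬ Overlaps B X := by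
    intro B hB hBX
    have hsub : B ∪ X ⊆ X := hX.2
      ⟨hclosed B hB.1 X hX.1.1 hBX, Set.union_subset (Set.subset_sUnion_of_mem hB) hX.1.2⟩
      Set.subset_union_right
    obtain ⟨x, hx, hx'⟩ := hBX.2.1
    exact hx' (hsub (.inl hx))
  rw [(sUnion_overlapClass_subset hAX key).antisymm hX.1.2]
  exact hX.1.1

theorem isStrong_sUnion_overlapClass {V : Type*} [Finite V] {F : Set (Set V)}
    (hclosed : ∀ A ∈ F, ∀ B ∈ F, Overlaps A B → A ∪ B ∈ F) {A : Set V} (hA : A ∈ F) :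
    IsStrong F (⋃₀ overlapClass F A) := by
  refine ⟨sUnion_overlapClass_mem hclosed hA, fun X hX _ hov => ?_⟩
  obtain ⟨⟨x, ⟨B, hB, hxB⟩, hxX⟩, hnot, ⟨y, hyX, hy⟩⟩ := hov
  have hno : ∀ B ∈ overlapClass F A, ¬ Overlaps B X := fun B hB h =>
    hy ⟨X, mem_overlapClass_of_ovRel hB ⟨hB.1, hX, h⟩, hyX⟩
  have hBX : B ⊆ X := by
    rcases not_overlaps_iff.1 (hno B hB) with h | h | h
    · exact absurd ⟨x, hxB, hxX⟩ h
    · exact h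
    · exact absurd ⟨B, hB, h hyX⟩ hy
  rw [← overlapClass_eq_of_mem hB] at hno hnot
  exact Set.sdiff_nonempty.1 hnot (sUnion_overlapClass_subset hBX hno)

/-- A weak member is a weak child of the support of its overlap class. -/
theorem isWeakChild_sUnion_overlapClass {V : Type*} [Finite V] {F : Set (Set V)}
    (hclosed : ∀ A ∈ F, ∀ B ∈ F, Overlaps A B → A ∪ B ∈ F) {A : Set V} (hA : A ∈ F)
    (hweak : ¬ IsStrong F A) : IsWeakChild F A (⋃₀ overlapClass F A) := by
  obtain ⟨B, hAB⟩ := exists_ovRel_of_not_isStrong hA hweak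
  have hB := mem_overlapClass_of_ovRel (mem_overlapClass_self hA) hAB
  obtain ⟨x, hxB, hxA⟩ := hAB.2.2.2.2
  refine ⟨⟨hA, isStrong_sUnion_overlapClass hclosed hA,
    ⟨Set.subset_sUnion_of_mem (mem_overlapClass_self hA), fun h => hxA (h ⟨B, hB, hxB⟩)⟩,
    fun Q hQ hAQ => ?_⟩, hweak⟩
  exact sUnion_overlapClass_subset hAQ.1 fun B hB h => hQ.not_overlaps hB.1 h.symm

theorem IsWeakChild.sUnion_overlapClass_eq {V : Type*} [Finite V] {F : Set (Set V)}
    (hclosed : ∀ A ∈ F, ∀ B ∈ F, Overlaps A B → A ∪ B ∈ F) {M D : Set V}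
    (h : IsWeakChild F M D) : ⋃₀ overlapClass F M = D := by
  have h' := isWeakChild_sUnion_overlapClass hclosed h.1.1 h.2
  exact (h'.1.2.2.2 D h.1.2.1 h.1.2.2.1).antisymm (h.1.2.2.2 _ h'.1.2.1 h'.1.2.2.1)

theorem not_isStrong_of_mem_overlapClass {V : Type*} {F : Set (Set V)} {A B : Set V}
    (hweak : ¬ IsStrong F A) (hB : B ∈ overlapClass F A) : ¬ IsStrong F B := by
  intro hs
  rcases Relation.ReflTransGen.cases_tail hB.2 with h | ⟨M, -, hMB⟩
  · exact hweak (h ▸ hs)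
  · exact hs.not_overlaps hMB.1 hMB.2.2.symm

/-- The overlap class of a weak member consists of the weak children of its support. -/
theorem overlapClass_eq_setOf_isWeakChild {V : Type*} [Finite V] {F : Set (Set V)}
    (hclosed : ∀ A ∈ F, ∀ B ∈ F, Overlaps A B → A ∪ B ∈ F) {A : Set V}
    (hweak : ¬ IsStrong F A) :
    overlapClass F A = {M | IsWeakChild F M (⋃₀ overlapClass F A)} := by
  have hchild : ∀ B ∈ overlapClass F A, IsWeakChild F B (⋃₀ overlapClass F A) := by
    intro B hB
    rw [← overlapClass_eq_of_mem hB]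
    exact isWeakChild_sUnion_overlapClass hclosed hB.1
      (not_isStrong_of_mem_overlapClass hweak hB)
  refine Set.Subset.antisymm hchild fun N hN => ?_
  have hND := hN.sUnion_overlapClass_eq hclosed
  obtain ⟨N', hNN'⟩ := exists_ovRel_of_not_isStrong hN.1.1 hN.2
  obtain ⟨x, hxN, -⟩ := hNN'.2.2.1
  obtain ⟨M, hM, hxM⟩ := hN.1.2.2.1.1 hxN
  by_contra hNA
  have hdisj : ∀ B ∈ overlapClass F A, B ∉ overlapClass F N := fun B hB hB' =>
    hNA (overlapClass_eq_of_mem hB ▸ (overlapClass_eq_of_mem hB').symm ▸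
      mem_overlapClass_self hN.1.1)
  have hno : ∀ B ∈ overlapClass F A, ∀ B' ∈ overlapClass F N, ¬ Overlaps B B' :=
    fun B hB B' hB' h => hdisj B' (mem_overlapClass_of_ovRel hB ⟨hB.1, hB'.1, h⟩) hB'
  have hNN := mem_overlapClass_self hN.1.1
  rcases not_overlaps_iff.1 (hno M hM N hNN) with h | h | h
  · exact h ⟨x, hxM, hxN⟩
  · refine hN.1.2.2.1.2 ?_
    rw [← overlapClass_eq_of_mem hM]
    exact sUnion_overlapClass_subset h fun B hB =>
      hno B (overlapClass_eq_of_mem hM ▸ hB) N hNN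
  · refine (hchild M hM).1.2.2.1.2 ?_
    rw [← hND]
    exact sUnion_overlapClass_subset h fun B hB hov => hno M hM B hB hov.symm

theorem not_isStrong_of_overlapClass_nontrivial {V : Type*} {F : Set (Set V)} {A : Set V}
    (hA : A ∈ F) (h : ¬ ∃ B, overlapClass F A = {B}) : ¬ IsStrong F A := by
  intro hs
  refine h ⟨A, Set.eq_singleton_iff_unique_mem.2 ⟨mem_overlapClass_self hA, fun B hB => ?_⟩⟩
  rcases Relation.ReflTransGen.cases_head hB.2 with h | ⟨M, hAM, -⟩
  · exact h.symm
  · exact absurd hAM.2.2 (hs.not_overlaps hAM.2.1)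

theorem overlapClass_nontrivial_of_not_isStrong {V : Type*} {F : Set (Set V)} {A : Set V}
    (hA : A ∈ F) (hweak : ¬ IsStrong F A) : ¬ ∃ B, overlapClass F A = {B} := by
  rintro ⟨B, hB⟩
  obtain ⟨M, hAM⟩ := exists_ovRel_of_not_isStrong hA hweak
  have hAB : A ∈ ({B} : Set (Set V)) := hB ▸ mem_overlapClass_self hA
  have hMB : M ∈ ({B} : Set (Set V)) :=
    hB ▸ mem_overlapClass_of_ovRel (mem_overlapClass_self hA) hAM
  exact hAM.2.2.ne (hAB.trans hMB.symm)

/-- For a family `F` containing the ground set and all singletons, closed under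
union of overlapping members, the support map is a bijection between the
nontrivial overlap classes of `F` and the decomposable strong members of `F`;
moreover the class with support `D` consists exactly of the weak children of `D`. -/
theorem overlapClass_support_bijection {V : Type*} [Fintype V]
    (F : Set (Set V)) (hV : Set.univ ∈ F) (hsing : ∀ v : V, {v} ∈ F)
    (hclosed : ∀ A ∈ F, ∀ B ∈ F, Overlaps A B → A ∪ B ∈ F) :
    (∀ C, IsOverlapClass F C → (¬ ∃ B, C = {B}) →
        IsDecomposable F (⋃₀ C) ∧ C = {M | IsWeakChild F M (⋃₀ C)}) ∧
    (∀ D, IsDecomposable F D →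
        ∃! C, IsOverlapClass F C ∧ (¬ ∃ B, C = {B}) ∧ ⋃₀ C = D) := by
  have hfst : ∀ C, IsOverlapClass F C → (¬ ∃ B, C = {B}) →
      IsDecomposable F (⋃₀ C) ∧ C = {M | IsWeakChild F M (⋃₀ C)} := by
    rintro C ⟨A, hA, hC⟩ hnontriv
    change C = overlapClass F A at hC
    subst hC
    have hweak := not_isStrong_of_overlapClass_nontrivial hA hnontriv
    exact ⟨⟨isStrong_sUnion_overlapClass hclosed hA, A,
      isWeakChild_sUnion_overlapClass hclosed hA hweak⟩,
      overlapClass_eq_setOf_isWeakChild hclosed hweak⟩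
  refine ⟨hfst, ?_⟩
  rintro D ⟨-, M, hM⟩
  refine ⟨overlapClass F M, ⟨⟨M, hM.1.1, rfl⟩,
    overlapClass_nontrivial_of_not_isStrong hM.1.1 hM.2, hM.sUnion_overlapClass_eq hclosed⟩, ?_⟩
  rintro C ⟨hC, hnontriv, hCD⟩
  rw [(hfst C hC hnontriv).2, hCD, overlapClass_eq_setOf_isWeakChild hclosed hM.2,
    hM.sUnion_overlapClass_eq hclosed]
end

section
/- Let H be a homogeneous relation on a finite set V. If H fulfills axiom A1, then H fulfills axiom A3. -/
/-- Axiom A1: `H(x|yz) ∧ H(y|xz) ⇒ H(z|xy)` on reflectless triples. -/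
def AxiomA1 {V : Type*} (H : V → V → V → Prop) : Prop :=
  ∀ x y z : V, x ≠ y → x ≠ z → y ≠ z → H x y z → H y x z → H z x y

/-- Axiom A3: `H(x|st) ∧ H(y|st) ∧ H(t|sx) ∧ H(t|sy) ⇒ H(s|xy)` on reflectless triples. -/
def AxiomA3 {V : Type*} (H : V → V → V → Prop) : Prop :=
  ∀ s t x y : V, x ≠ s → x ≠ t → y ≠ s → y ≠ t → t ≠ s →
    H x s t → H y s t → H t s x → H t s y → H s x y

/-- If a homogeneous relation fulfills A1 then it fulfills A3. -/
theorem axiomA1_implies_axiomA3 {V : Type*} [Fintype V]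
    (H : V → V → V → Prop) (hH : IsHomRel H) (h1 : AxiomA1 H) : AxiomA3 H := by
  obtain ⟨hsymm, -, htrans⟩ := hH
  intro s t x y hxs hxt hys hyt hts hx hy htx hty
  have hsx : H s x t := h1 x t s hxt hxs hts (hsymm x s t hx) (hsymm t s x htx)
  have hsy : H s y t := h1 y t s hyt hys hts (hsymm y s t hy) (hsymm t s y hty)
  exact htrans s x t y hsx (hsymm s y t hsy)
end

section
/- Let H be a homogeneous relation on a finite set V that fulfills axiom A2 or axiom A3. Then the family F_H of homogeneous sets of H is weakly partitive: it contains V and all singletons, and for all overlapping A, B ∈ F_H, the sets A ∩ B, A ∪ B and A \ B belong to F_H. -/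
/-- Axiom A2: `H(x|st) ∧ H(y|st) ∧ H(t|xy) ⇒ H(s|xy)` on reflectless triples. -/
def AxiomA2 {V : Type*} (H : V → V → V → Prop) : Prop :=
  ∀ s t x y : V, x ≠ s → x ≠ t → y ≠ s → y ≠ t → H x s t → H y s t → H t x y → H s x y

section

variable {V : Type*} {H : V → V → V → Prop} {A B : Set V}

theorem isHomSet_univ [Nonempty V] : IsHomSet H (Set.univ : Set V) :=
  ⟨Set.univ_nonempty, fun s hs => absurd (Set.mem_univ s) hs⟩

theorem IsHomRel.isHomSet_singleton (hH : IsHomRel H) (v : V) : IsHomSet H {v} := by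
  refine ⟨Set.singleton_nonempty v, ?_⟩
  rintro s hs x rfl y rfl
  exact hH.2.1 s _ hs

theorem IsHomSet.inter_s11 (hA : IsHomSet H A) (hB : IsHomSet H B) (h : (A ∩ B).Nonempty) :
    IsHomSet H (A ∩ B) := by
  refine ⟨h, fun s hs x hx y hy => ?_⟩
  by_cases hsA : s ∈ A
  · exact hB.2 s (fun hsB => hs ⟨hsA, hsB⟩) x hx.2 y hy.2
  · exact hA.2 s hsA x hx.1 y hy.1

theorem IsHomSet.union_s11 (hH : IsHomRel H) (hA : IsHomSet H A) (hB : IsHomSet H B)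
    (h : (A ∩ B).Nonempty) : IsHomSet H (A ∪ B) := by
  obtain ⟨z, hzA, hzB⟩ := h
  refine ⟨⟨z, Or.inl hzA⟩, fun s hs => ?_⟩
  have hsz : ∀ x ∈ A ∪ B, H s x z := by
    rintro x (hx | hx)
    · exact hA.2 s (fun h => hs (Or.inl h)) x hx z hzA
    · exact hB.2 s (fun h => hs (Or.inr h)) x hx z hzB
  exact fun x hx y hy => hH.2.2 s x z y (hsz x hx) (hH.1 s y z (hsz y hy))

theorem IsHomSet.diff (hax : AxiomA2 H ∨ AxiomA3 H) (hA : IsHomSet H A) (hB : IsHomSet H B)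
    (hAB : (A \ B).Nonempty) (hBA : (B \ A).Nonempty) : IsHomSet H (A \ B) := by
  refine ⟨hAB, fun s hs x hx y hy => ?_⟩
  by_cases hsA : s ∈ A
  · have hsB : s ∈ B := by_contra fun h => hs ⟨hsA, h⟩
    obtain ⟨t, htB, htA⟩ := hBA
    have hxs : x ≠ s := (ne_of_mem_of_not_mem hsB hx.2).symm
    have hys : y ≠ s := (ne_of_mem_of_not_mem hsB hy.2).symm
    have hxt : x ≠ t := ne_of_mem_of_not_mem hx.1 htA
    have hyt : y ≠ t := ne_of_mem_of_not_mem hy.1 htA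
    have hts : t ≠ s := (ne_of_mem_of_not_mem hsA htA).symm
    have hxst : H x s t := hB.2 x hx.2 s hsB t htB
    have hyst : H y s t := hB.2 y hy.2 s hsB t htB
    rcases hax with h2 | h3
    · exact h2 s t x y hxs hxt hys hyt hxst hyst (hA.2 t htA x hx.1 y hy.1)
    · exact h3 s t x y hxs hxt hys hyt hts hxst hyst
        (hA.2 t htA s hsA x hx.1) (hA.2 t htA s hsA y hy.1)
  · exact hA.2 s hsA x hx.1 y hy.1

end

/-- If a homogeneous relation fulfills A2 or A3, its homogeneous sets form a
weakly partitive family: it contains the ground set and all singletons, and is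
closed under intersection, union and difference of overlapping members. -/
theorem homSets_weakly_partitive {V : Type*} [Fintype V] [Nonempty V]
    (H : V → V → V → Prop) (hH : IsHomRel H) (hax : AxiomA2 H ∨ AxiomA3 H) :
    IsHomSet H (Set.univ : Set V) ∧ (∀ v : V, IsHomSet H {v}) ∧
    ∀ A B : Set V, IsHomSet H A → IsHomSet H B → Overlaps A B →
      IsHomSet H (A ∩ B) ∧ IsHomSet H (A ∪ B) ∧ IsHomSet H (A \ B) := by
  refine ⟨isHomSet_univ, hH.isHomSet_singleton, fun A B hA hB hAB => ?_⟩
  obtain ⟨hinter, hAB, hBA⟩ := hAB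
  exact ⟨hA.inter_s11 hB hinter, hA.union_s11 hH hB hinter, hA.diff hax hB hAB hBA⟩
end

section
/- Let G be a simple undirected graph on a finite vertex set V, and define H_G(s|xy), for s ≠ x and s ≠ y, to hold if and only if (s is adjacent to x ⇔ s is adjacent to y). Then H_G is a homogeneous relation on V and it fulfills axioms A1, A2, A3 and A4. -/
/-- Axiom A4: `¬H(x|yz) ∧ ¬H(y|xz) ⇒ H(z|xy)` on reflectless triples. -/
def AxiomA4 {V : Type*} (H : V → V → V → Prop) : Prop :=
  ∀ x y z : V, x ≠ y → x ≠ z → y ≠ z → ¬ H x y z → ¬ H y x z → H z x y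

/-- The homogeneous relation of a simple undirected graph (`H(s|xy)` iff `s` is
adjacent to `x` exactly when it is adjacent to `y`) is a homogeneous relation
fulfilling A1, A2, A3 and A4. -/
theorem graph_homRel_axioms {V : Type*} [Fintype V] (G : SimpleGraph V) :
    IsHomRel (fun s x y => G.Adj s x ↔ G.Adj s y) ∧
    AxiomA1 (fun s x y => G.Adj s x ↔ G.Adj s y) ∧
    AxiomA2 (fun s x y => G.Adj s x ↔ G.Adj s y) ∧
    AxiomA3 (fun s x y => G.Adj s x ↔ G.Adj s y) ∧
    AxiomA4 (fun s x y => G.Adj s x ↔ G.Adj s y) := by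
  refine ⟨⟨fun _ _ _ h => h.symm, fun _ _ _ => Iff.rfl, fun _ _ _ _ h k => h.trans k⟩,
    ?_, ?_, ?_, ?_⟩
  · intro x y z _ _ _ hx hy
    rw [G.adj_comm z x, G.adj_comm z y, ← hx, ← hy, G.adj_comm]
  · intro s t x y _ _ _ _ hx hy ht
    rw [G.adj_comm s x, G.adj_comm s y, hx, hy, G.adj_comm x t, G.adj_comm y t, ht]
  · intro s t x y _ _ _ _ _ hx hy hsx hsy
    rw [G.adj_comm s x, G.adj_comm s y, hx, hy, G.adj_comm x t, G.adj_comm y t, ← hsx, ← hsy]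
  · intro x y z _ _ _ hx hy
    simp only [G.adj_comm y x, G.adj_comm z x, G.adj_comm z y] at hx hy ⊢
    tauto
end

section
/- Let D be a directed graph on a finite vertex set V given by an arc relation r : V × V → Prop, and define H_D(s|xy), for s ≠ x and s ≠ y, to hold if and only if (r(s,x) ⇔ r(s,y)) and (r(x,s) ⇔ r(y,s)). Then H_D is a homogeneous relation on V and it fulfills axioms A2 and A3. -/
/-- The homogeneous relation of a directed graph with arc relation `r`
(`H(s|xy)` iff `s` has the same in- and out-adjacency towards `x` and `y`) is a
homogeneous relation fulfilling A2 and A3. -/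
theorem digraph_homRel_axioms {V : Type*} [Fintype V] (r : V → V → Prop) :
    IsHomRel (fun s x y => (r s x ↔ r s y) ∧ (r x s ↔ r y s)) ∧
    AxiomA2 (fun s x y => (r s x ↔ r s y) ∧ (r x s ↔ r y s)) ∧
    AxiomA3 (fun s x y => (r s x ↔ r s y) ∧ (r x s ↔ r y s)) := by
  refine ⟨⟨?_, ?_, ?_⟩, ?_, ?_⟩
  · exact fun _ _ _ h => ⟨h.1.symm, h.2.symm⟩
  · exact fun _ _ _ => ⟨Iff.rfl, Iff.rfl⟩
  · exact fun _ _ _ _ h h' => ⟨h.1.trans h'.1, h.2.trans h'.2⟩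
  · exact fun _ _ _ _ _ _ _ _ hx hy ht =>
      ⟨hx.2.trans (ht.1.trans hy.2.symm), hx.1.trans (ht.2.trans hy.1.symm)⟩
  · exact fun _ _ _ _ _ _ _ _ _ hx hy htx hty =>
      ⟨hx.2.trans (htx.1.symm.trans (hty.1.trans hy.2.symm)),
        hx.1.trans (htx.2.symm.trans (hty.2.trans hy.1.symm))⟩
end
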